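/- Let λ be a nonzero real number, let f(x) = Σ_{m=0}^d a_m x^m be a real polynomial, and let x be a real number with |x| < 1. Then the series Σ_{n=1}^∞ H_{n,λ} · (Σ_{m=0}^d a_m (n)_{m,λ}) · x^n converges absolutely and equals (1/(1−x)) · Σ_{m=0}^d a_m · HF_{m,λ}(x/(1−x)) − (log_λ(1−x)/(1−x)) · Σ_{m=0}^d a_m · F^{(1−λ)}_{m,λ}(x/(1−x)), where log_λ(1−x) = ((1−x)^λ − 1)/λ. -/

import Mathlib

open Finset

/-- The degenerate falling factorial `(x)_{n,λ} = x(x-λ)⋯(x-(n-1)λ)`. -/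
noncomputable def degFall (lam x : ℝ) (n : ℕ) : ℝ := ∏ i ∈ Finset.range n, (x - (i : ℝ) * lam)

/-- The ordinary falling factorial `(x)_n = x(x-1)⋯(x-n+1)`. -/
noncomputable def fall (x : ℝ) (n : ℕ) : ℝ := ∏ i ∈ Finset.range n, (x - (i : ℝ))

/-- The rising factorial `⟨a⟩_k = a(a+1)⋯(a+k-1)`. -/
noncomputable def rising (a : ℝ) (k : ℕ) : ℝ := ∏ i ∈ Finset.range k, (a + (i : ℝ))

/-- The generalized binomial coefficient `binom(a,k) = a(a-1)⋯(a-k+1)/k!`. -/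
noncomputable def rchoose (a : ℝ) (k : ℕ) : ℝ :=
  (∏ i ∈ Finset.range k, (a - (i : ℝ))) / (k.factorial : ℝ)

/-- The degenerate harmonic numbers `H_{n,λ} = Σ_{k=1}^n (1/k)·binom(k-1-λ, k-1)`. -/
noncomputable def degH (lam : ℝ) (n : ℕ) : ℝ :=
  ∑ k ∈ Finset.Icc 1 n, (1 / (k : ℝ)) * rchoose ((k : ℝ) - 1 - lam) (k - 1)

/-- The degenerate hyperharmonic numbers `H^{(r)}_{n,λ}`. -/
noncomputable def degHyperH (lam : ℝ) : ℕ → ℕ → ℝ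
  | 0, _ => 0
  | 1, n => degH lam n
  | r + 2, n => ∑ k ∈ Finset.Icc 1 n, degHyperH lam (r + 1) k

/-- The degenerate harmonic-Fubini polynomial built from degenerate Stirling numbers `S2`. -/
noncomputable def HFpoly (lam : ℝ) (S2 : ℕ → ℕ → ℝ) (n : ℕ) (x : ℝ) : ℝ :=
  ∑ k ∈ Finset.Icc 1 n, S2 n k * degH lam k * (k.factorial : ℝ) * x ^ k

/-- The degenerate Fubini polynomial of order `1-λ` built from degenerate Stirling numbers `S2`. -/
noncomputable def Fpoly (lam : ℝ) (S2 : ℕ → ℕ → ℝ) (n : ℕ) (x : ℝ) : ℝ :=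
  ∑ k ∈ Finset.range (n + 1), rising (1 - lam) k * S2 n k * x ^ k

/-- The degenerate hyperharmonic-Fubini polynomial built from degenerate Stirling numbers `S2`. -/
noncomputable def HFpolyR (lam : ℝ) (S2 : ℕ → ℕ → ℝ) (r n : ℕ) (y : ℝ) : ℝ :=
  ∑ k ∈ Finset.Icc 1 n, S2 n k * degHyperH lam r k * (k.factorial : ℝ) * y ^ k

/-- The degenerate falling factorial power of the operator `θ = x·d/dx`:
`(θ)_{k,λ} = (θ - (k-1)λ) ∘ ⋯ ∘ (θ - λ) ∘ θ`. -/
noncomputable def thetaFall (lam : ℝ) : ℕ → (ℝ → ℝ) → ℝ → ℝ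
  | 0, g => g
  | k + 1, g => fun x => x * deriv (thetaFall lam k g) x - (k : ℝ) * lam * thetaFall lam k g x

theorem rising_succ (a : ℝ) (k : ℕ) : rising a (k + 1) = rising a k * (a + k) :=
  Finset.prod_range_succ _ _

theorem rising_add (a : ℝ) (k m : ℕ) : rising a (k + m) = rising a k * rising (a + k) m := by
  simp [rising, Finset.prod_range_add, add_assoc]

theorem rising_one (k : ℕ) : rising 1 k = (k.factorial : ℝ) := by
  induction k with
  | zero => simp [rising]
  | succ k ih =>
    rw [rising_succ, ih, Nat.factorial_succ]
    push_cast
    ring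

theorem rising_eq_factorial_mul_choose (a : ℝ) (k : ℕ) :
    rising a k = (k.factorial : ℝ) * Ring.choose (a + k - 1) k := by
  have h : ∀ k : ℕ, (ascPochhammer ℝ k).eval a = rising a k := by
    intro k
    induction k with
    | zero => simp [rising]
    | succ k ih => rw [ascPochhammer_succ_eval, ih, rising_succ]
  rw [← Ring.multichoose_eq, ← nsmul_eq_mul, Ring.factorial_nsmul_multichoose_eq_ascPochhammer,
    Polynomial.ascPochhammer_smeval_eq_eval, h]

theorem fall_natCast (n k : ℕ) : fall (n : ℝ) k = (n.descFactorial k : ℝ) := by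
  rw [← descPochhammer_eval_eq_descFactorial, descPochhammer_eval_eq_prod_range, fall]

theorem rchoose_eq_rising (a : ℝ) (k : ℕ) :
    rchoose (k + a - 1) k = rising a k / (k.factorial : ℝ) := by
  rw [rchoose, rising, ← Finset.prod_range_reflect]
  congr 1
  refine Finset.prod_congr rfl fun i hi => ?_
  have hi : i + 1 ≤ k := Finset.mem_range.1 hi
  rw [Nat.sub_sub, Nat.cast_sub (by omega)]
  push_cast
  ring

/-- Closed form `λ H_{n,λ} = 1 - ⟨1-λ⟩_n / n!`. -/
theorem mul_degH (lam : ℝ) (n : ℕ) :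
    lam * degH lam n = 1 - rising (1 - lam) n / (n.factorial : ℝ) := by
  induction n with
  | zero => simp [degH, rising]
  | succ n ih =>
    have h : degH lam (n + 1)
        = degH lam n + 1 / ((n : ℝ) + 1) * (rising (1 - lam) n / (n.factorial : ℝ)) := by
      rw [degH, Finset.sum_Icc_succ_top (by omega), ← degH, ← rchoose_eq_rising]
      push_cast
      congr 3
      ring
    rw [h, mul_add, ih, rising_succ, Nat.factorial_succ]
    push_cast
    field_simp
    ring

/-- The binomial series `∑ ⟨a⟩_n / n! x^n = (1 - x)^(-a)`. -/
theorem hasSum_rising (a : ℝ) {x : ℝ} (hx : |x| < 1) :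
    HasSum (fun n : ℕ => rising a n / (n.factorial : ℝ) * x ^ n) ((1 - x) ^ (-a)) := by
  have h := (Real.one_div_one_sub_rpow_hasFPowerSeriesOnBall_zero a).hasSum (y := x)
    (by simpa [enorm_eq_nnnorm, ← NNReal.coe_lt_coe] using hx)
  have h1 : 0 ≤ 1 - x := by linarith [(abs_lt.1 hx).2]
  rw [zero_add, one_div, ← Real.rpow_neg h1] at h
  refine h.congr_fun ?_
  intro n
  rw [rising_eq_factorial_mul_choose, mul_div_cancel_left₀ _ (by positivity)]
  simp [mul_comm]

theorem hasSum_rising_mul_fall (a : ℝ) (k : ℕ) {x : ℝ} (hx : |x| < 1) :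
    HasSum (fun n : ℕ => rising a n / (n.factorial : ℝ) * fall n k * x ^ n)
      (rising a k * (x / (1 - x)) ^ k * (1 - x) ^ (-a)) := by
  have h1 : 0 < 1 - x := by linarith [(abs_lt.1 hx).2]
  rw [← hasSum_nat_add_iff' k, Finset.sum_eq_zero, sub_zero]
  · have h := (hasSum_rising (a + k) hx).mul_left (rising a k * x ^ k)
    rw [neg_add, Real.rpow_add h1, Real.rpow_neg h1.le (k : ℝ), Real.rpow_natCast] at h
    convert! h using 1
    · ext n
      have hf := Nat.factorial_mul_descFactorial (Nat.le_add_left k n)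
      rw [Nat.add_sub_cancel] at hf
      have hd : (((n + k).descFactorial k : ℕ) : ℝ) = (n + k).factorial / n.factorial := by
        rw [eq_div_iff (by positivity), ← hf]
        push_cast
        ring
      rw [fall_natCast, hd, add_comm n k, rising_add, pow_add]
      have := Nat.factorial_ne_zero (k + n)
      field_simp
    · rw [div_pow]
      ring
  · intro n hn
    rw [fall_natCast, Nat.descFactorial_of_lt (Finset.mem_range.1 hn)]
    simp

theorem hasSum_degH_mul_fall {lam : ℝ} (hlam : lam ≠ 0) (k : ℕ) {x : ℝ} (hx : |x| < 1) :
    HasSum (fun n : ℕ => degH lam n * fall n k * x ^ n)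
      (1 / (1 - x) * (degH lam k * (k.factorial : ℝ) * (x / (1 - x)) ^ k)
        - ((1 - x) ^ lam - 1) / lam / (1 - x) * (rising (1 - lam) k * (x / (1 - x)) ^ k)) := by
  have h1 : 0 < 1 - x := by linarith [(abs_lt.1 hx).2]
  have hH : ∀ n, degH lam n = (1 - rising (1 - lam) n / (n.factorial : ℝ)) / lam := fun n => by
    rw [← mul_degH, mul_div_cancel_left₀ _ hlam]
  have h := ((hasSum_rising_mul_fall 1 k hx).sub
    (hasSum_rising_mul_fall (1 - lam) k hx)).div_const lam
  rw [neg_sub, Real.rpow_sub h1, Real.rpow_neg h1.le, Real.rpow_one, rising_one] at h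
  convert! h using 1
  · ext n
    rw [hH, rising_one, div_self (by positivity)]
    ring
  · rw [hH]
    field_simp
    ring

theorem HFpoly_eq_sum_range (lam : ℝ) (S2 : ℕ → ℕ → ℝ) (n : ℕ) (x : ℝ) :
    HFpoly lam S2 n x
      = ∑ k ∈ Finset.range (n + 1), S2 n k * degH lam k * (k.factorial : ℝ) * x ^ k := by
  rw [HFpoly, Finset.range_eq_Ico, Finset.sum_eq_sum_Ico_succ_bot (by omega)]
  simp [degH, Finset.Ico_add_one_right_eq_Icc]

theorem hasSum_degH_mul_degFall {lam : ℝ} (hlam : lam ≠ 0) {x : ℝ} (hx : |x| < 1)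
    {S2 : ℕ → ℕ → ℝ} {m : ℕ}
    (hS2 : ∀ z : ℝ, degFall lam z m = ∑ k ∈ Finset.range (m + 1), S2 m k * fall z k) :
    HasSum (fun n : ℕ => degH lam n * degFall lam n m * x ^ n)
      (1 / (1 - x) * HFpoly lam S2 m (x / (1 - x))
        - ((1 - x) ^ lam - 1) / lam / (1 - x) * Fpoly lam S2 m (x / (1 - x))) := by
  have h := hasSum_sum fun k (_ : k ∈ Finset.range (m + 1)) =>
    (hasSum_degH_mul_fall hlam k hx).mul_left (S2 m k)
  convert! h using 1
  · ext n
    rw [hS2, Finset.mul_sum, Finset.sum_mul]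
    exact Finset.sum_congr rfl fun k _ => by ring
  · rw [HFpoly_eq_sum_range, Fpoly, Finset.mul_sum, Finset.mul_sum, ← Finset.sum_sub_distrib]
    exact Finset.sum_congr rfl fun k _ => by ring

theorem stmt8 (lam : ℝ) (hlam : lam ≠ 0) (d : ℕ) (a : ℕ → ℝ) (x : ℝ) (hx : |x| < 1)
    (S2 : ℕ → ℕ → ℝ)
    (hS2 : ∀ (m : ℕ) (z : ℝ), degFall lam z m = ∑ k ∈ Finset.range (m + 1), S2 m k * fall z k) :
    Summable (fun n : ℕ =>
      |degH lam n * (∑ m ∈ Finset.range (d + 1), a m * degFall lam (n : ℝ) m) * x ^ n|) ∧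
    ∑' n : ℕ, degH lam n * (∑ m ∈ Finset.range (d + 1), a m * degFall lam (n : ℝ) m) * x ^ n
      = (1 / (1 - x)) * ∑ m ∈ Finset.range (d + 1), a m * HFpoly lam S2 m (x / (1 - x))
        - (((1 - x) ^ lam - 1) / lam / (1 - x)) *
            ∑ m ∈ Finset.range (d + 1), a m * Fpoly lam S2 m (x / (1 - x)) := by
  have h := hasSum_sum fun m (_ : m ∈ Finset.range (d + 1)) =>
    (hasSum_degH_mul_degFall hlam hx (hS2 m)).mul_left (a m)
  have key : HasSum (fun n : ℕ =>
      degH lam n * (∑ m ∈ Finset.range (d + 1), a m * degFall lam (n : ℝ) m) * x ^ n)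
      ((1 / (1 - x)) * ∑ m ∈ Finset.range (d + 1), a m * HFpoly lam S2 m (x / (1 - x))
        - (((1 - x) ^ lam - 1) / lam / (1 - x)) *
            ∑ m ∈ Finset.range (d + 1), a m * Fpoly lam S2 m (x / (1 - x))) := by
    convert! h using 1
    · ext n
      rw [Finset.mul_sum, Finset.sum_mul]
      exact Finset.sum_congr rfl fun m _ => by ring
    · rw [Finset.mul_sum, Finset.mul_sum, ← Finset.sum_sub_distrib]
      exact Finset.sum_congr rfl fun m _ => by ring
  exact ⟨key.summable.abs, key.tsum_eq⟩
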